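/- Let φ be a smooth positive function on 𝕊ⁿ and fix x ∈ 𝕊ⁿ. Choose a local orthonormal frame such that the Hessian (φ_{ij}) is diagonal at x. Then at x, for all indices i, α, the second covariant derivatives of A = A[φ] satisfy: A_{iiαα} − A_{ααii} = −(Σ_m A_{ααm} φ_m)/φ − [ −2φ_α²/φ² + |Dφ|²/(2φ²) + A_{αα}/φ + (1/2)(1 + 1/φ²) ] A_{αα} + (Σ_m A_{iim} φ_m)/φ + [ −2φ_i²/φ² + |Dφ|²/(2φ²) + A_{ii}/φ + (1/2)(1 + 1/φ²) ] A_{ii}. -/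

import Mathlib

open scoped RealInnerProductSpace
open Finset

noncomputable section

/-- Euclidean space `ℝ^(n+1)`, the ambient space of the unit sphere `𝕊ⁿ`. -/
abbrev Euc (n : ℕ) : Type := EuclideanSpace ℝ (Fin (n + 1))

/-- The unit sphere `𝕊ⁿ ⊆ ℝ^(n+1)`. -/
def uSphere (n : ℕ) : Set (Euc n) := Metric.sphere (0 : Euc n) 1

/-- Orthogonal projection onto the tangent space of the sphere at (the normalization of) `x`. -/
def tanProj {n : ℕ} (x v : Euc n) : Euc n := v - (⟪x, v⟫ / ‖x‖ ^ 2) • x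

/-- `f` is (the 0-homogeneous extension of) a function on the sphere. -/
def Homog0 {n : ℕ} (f : Euc n → ℝ) : Prop := ∀ (c : ℝ) (y : Euc n), 0 < c → f (c • y) = f y

/-- Smoothness of a function on the sphere, expressed via its 0-homogeneous extension. -/
def SmoothFn {n : ℕ} (f : Euc n → ℝ) : Prop := ContDiffOn ℝ (⊤ : ℕ∞) f {y : Euc n | y ≠ 0}

/-- `f(x) = f(-x)` for all `x`. -/
def EvenFn {n : ℕ} (f : Euc n → ℝ) : Prop := ∀ y, f (-y) = f y

/-- Covariant (tangential) derivative of a function on the sphere, in direction `v`. -/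
def covD {n : ℕ} (f : Euc n → ℝ) (x v : Euc n) : ℝ := fderiv ℝ f x (tanProj x v)

/-- Spherical (tangential) gradient. -/
def gradS {n : ℕ} (f : Euc n → ℝ) (x : Euc n) : Euc n := tanProj x (gradient f x)

/-- Covariant Hessian `(D²f)(v,w)` of a function on the round sphere. -/
def hessS {n : ℕ} (f : Euc n → ℝ) (x v w : Euc n) : ℝ :=
  fderiv ℝ (fun y => covD f y w) x (tanProj x v)

/-- The symmetric 2-tensor
`A[φ](v,w) = (D²φ)(v,w) - (|Dφ|²/(2φ)) σ(v,w) + ((φ - 1/φ)/2) σ(v,w)` on the sphere. -/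
def Aform {n : ℕ} (φ : Euc n → ℝ) (x v w : Euc n) : ℝ :=
  hessS φ x v w +
    ((φ x - (φ x)⁻¹) / 2 - ‖gradS φ x‖ ^ 2 / (2 * φ x)) * ⟪tanProj x v, tanProj x w⟫

/-- `φ` is h-convex: `A[φ] ≥ 0` on the sphere. -/
def HConvex {n : ℕ} (φ : Euc n → ℝ) : Prop :=
  ∀ x ∈ uSphere n, ∀ v : Euc n, ⟪x, v⟫ = 0 → 0 ≤ Aform φ x v v

/-- `φ` is uniformly h-convex: `A[φ] > 0` on the sphere. -/
def UnifHConvex {n : ℕ} (φ : Euc n → ℝ) : Prop :=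
  ∀ x ∈ uSphere n, ∀ v : Euc n, ⟪x, v⟫ = 0 → v ≠ 0 → 0 < Aform φ x v v

/-- `σ_k` of a square matrix: the sum of its principal `k × k` minors
(equivalently, the `k`-th elementary symmetric function of its eigenvalues). -/
def sigmaMat {N : ℕ} (k : ℕ) (M : Matrix (Fin N) (Fin N) ℝ) : ℝ :=
  ∑ s ∈ Finset.powersetCard k (Finset.univ : Finset (Fin N)),
    Matrix.det (Matrix.of fun i j : {a : Fin N // a ∈ s} => M i.1 j.1)

/-- `e` is an orthonormal frame of the tangent space of `𝕊ⁿ` at `x`. -/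
def OrthoFrame {n : ℕ} (x : Euc n) (e : Fin n → Euc n) : Prop :=
  (∀ i, ⟪x, e i⟫ = 0) ∧ ∀ i j, ⟪e i, e j⟫ = if i = j then 1 else 0

/-- The matrix of `A[φ]` at `x` with respect to an orthonormal tangent frame `e`. -/
def Amat {n : ℕ} (φ : Euc n → ℝ) (x : Euc n) (e : Fin n → Euc n) : Matrix (Fin n) (Fin n) ℝ :=
  Matrix.of fun i j => Aform φ x (e i) (e j)

/-- `φ` solves the horospherical `p`-Christoffel-Minkowski equation
`σ_k(A[φ]) = φ^(p-k) f` on `𝕊ⁿ`. -/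
def SolvesCM (n k : ℕ) (p : ℝ) (f φ : Euc n → ℝ) : Prop :=
  ∀ x ∈ uSphere n, ∀ e : Fin n → Euc n, OrthoFrame x e →
    sigmaMat k (Amat φ x e) = φ x ^ (p - (k : ℝ)) * f x

/-- Supremum (maximum) of a function over the sphere. -/
def sphSup {n : ℕ} (f : Euc n → ℝ) : ℝ := sSup (f '' uSphere n)

/-- Infimum (minimum) of a function over the sphere. -/
def sphInf {n : ℕ} (f : Euc n → ℝ) : ℝ := sInf (f '' uSphere n)

/-- The function `f^(-1/q)`. -/
def negPowExt {n : ℕ} (f : Euc n → ℝ) (q : ℝ) : Euc n → ℝ := fun y => f y ^ (-(1 / q))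

/-- Assumption 1.3 of the paper (Assumption (A)): the gradient-and-Hessian conditions on the
prescribed function `f`, according to the value of `p`. -/
def AssumptionA (n k : ℕ) (p : ℝ) (f : Euc n → ℝ) : Prop :=
  ((p = 0) →
    ∀ x ∈ uSphere n, ∀ v : Euc n, ⟪x, v⟫ = 0 →
      0 ≤ hessS (negPowExt f (k : ℝ)) x v v - ‖gradS (negPowExt f (k : ℝ)) x‖ * ‖v‖ ^ 2 +
          negPowExt f (k : ℝ) x /
              (2 + 8 * sphSup fun y => (f y / (n.choose k : ℝ)) ^ (1 / (k : ℝ))) * ‖v‖ ^ 2) ∧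
  ((0 < p ∧ p ≤ (k : ℝ) / 2) →
    ∀ x ∈ uSphere n, ∀ v : Euc n, ⟪x, v⟫ = 0 →
      0 ≤ hessS (negPowExt f (k : ℝ)) x v v -
            (((k : ℝ) + 2 * p) / (k : ℝ)) * ‖gradS (negPowExt f (k : ℝ)) x‖ * ‖v‖ ^ 2 +
          (p ^ 2 / (k : ℝ) ^ 2) * negPowExt f (k : ℝ) x * ‖v‖ ^ 2) ∧
  (((k : ℝ) / 2 < p ∧ p < (k : ℝ)) →
    ∀ x ∈ uSphere n, ∀ v : Euc n, ⟪x, v⟫ = 0 →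
      0 ≤ hessS (negPowExt f (k : ℝ)) x v v -
            ((3 * (k : ℝ) - 2 * p) ^ 2 / (p * (2 * p - (k : ℝ)))) *
              (‖gradS (negPowExt f (k : ℝ)) x‖ ^ 2 / (2 * negPowExt f (k : ℝ) x)) * ‖v‖ ^ 2 +
          (p / (2 * (k : ℝ))) * negPowExt f (k : ℝ) x * ‖v‖ ^ 2) ∧
  (((k : ℝ) ≤ p ∧ p < 2 * (k : ℝ)) →
    ∀ x ∈ uSphere n, ∀ v : Euc n, ⟪x, v⟫ = 0 →
      0 ≤ hessS (negPowExt f p) x v v -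
            (‖gradS (negPowExt f p) x‖ ^ 2 / (2 * negPowExt f p x)) * ‖v‖ ^ 2 +
          (1 / 2) * negPowExt f p x * ‖v‖ ^ 2) ∧
  ((p = 2 * (k : ℝ)) →
    sphSup f < (n.choose k : ℝ) / 2 ^ k ∧
    ∀ x ∈ uSphere n, ∀ v : Euc n, ⟪x, v⟫ = 0 →
      0 ≤ hessS (negPowExt f p) x v v -
            (‖gradS (negPowExt f p) x‖ ^ 2 / (2 * negPowExt f p x)) * ‖v‖ ^ 2 +
          (1 / 2) * negPowExt f p x * ‖v‖ ^ 2) ∧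
  ((2 * (k : ℝ) < p) →
    2 ≤ k ∧
    sphInf f ≤
      (k : ℝ) ^ k * (p - 2 * (k : ℝ)) ^ ((p - 2 * (k : ℝ)) / 2) / p ^ (p / 2) * (n.choose k : ℝ) ∧
    ∀ x ∈ uSphere n, ∀ v : Euc n, ⟪x, v⟫ = 0 →
      0 ≤ hessS (negPowExt f p) x v v -
            (‖gradS (negPowExt f p) x‖ ^ 2 / (2 * negPowExt f p x)) * ‖v‖ ^ 2 +
          ((k : ℝ) / p) * negPowExt f p x * ‖v‖ ^ 2)

/-- First covariant derivative of the 2-tensor `A[φ]` on the round sphere: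
`covA1 φ x v w z = (∇_v A)(w, z) = A_{wz;v}`. -/
def covA1 {n : ℕ} (φ : Euc n → ℝ) (x v w z : Euc n) : ℝ :=
  fderiv ℝ (fun y => Aform φ y (tanProj y w) (tanProj y z)) x (tanProj x v)

/-- Second covariant derivative of `A[φ]`:
`covA2 φ x u v w z = (∇_u ∇_v A)(w, z) = A_{wz;v;u}`. -/
def covA2 {n : ℕ} (φ : Euc n → ℝ) (x u v w z : Euc n) : ℝ :=
  fderiv ℝ (fun y => covA1 φ y (tanProj y v) (tanProj y w) (tanProj y z)) x (tanProj x u)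

/-- The scalar coefficient of the metric in `A[φ]`, written with the ambient gradient. -/
def metricCoeff {n : ℕ} (φ : Euc n → ℝ) (y : Euc n) : ℝ :=
  (φ y - (φ y)⁻¹) / 2 - ‖gradient φ y‖ ^ 2 / (2 * φ y)

section LineDerivative

variable {E F : Type*} [NormedAddCommGroup E] [NormedSpace ℝ E] [NormedAddCommGroup F]
  [NormedSpace ℝ F]

theorem hasDerivAt_line (x v : E) : HasDerivAt (fun t : ℝ => x + t • v) v 0 := by
  simpa using ((hasDerivAt_id (0 : ℝ)).smul_const v).const_add x

theorem DifferentiableAt.hasDerivAt_comp_line {f : E → F} {x : E} (hf : DifferentiableAt ℝ f x)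
    (v : E) : HasDerivAt (fun t : ℝ => f (x + t • v)) (fderiv ℝ f x v) 0 := by
  have h : HasFDerivAt f (fderiv ℝ f x) (x + (0 : ℝ) • v) := by simpa using hf.hasFDerivAt
  exact h.comp_hasDerivAt (0 : ℝ) (hasDerivAt_line x v)

theorem DifferentiableAt.fderiv_apply_eq_of_line {f : E → F} {x v : E} {d : F}
    (hf : DifferentiableAt ℝ f x) (h : HasDerivAt (fun t : ℝ => f (x + t • v)) d 0) :
    fderiv ℝ f x v = d :=
  (hf.hasDerivAt_comp_line v).unique h

theorem DifferentiableAt.real_div {f g : E → ℝ} {x : E} (hf : DifferentiableAt ℝ f x)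
    (hg : DifferentiableAt ℝ g x) (h : g x ≠ 0) : DifferentiableAt ℝ (fun y => f y / g y) x := by
  simpa only [div_eq_mul_inv] using! hf.mul (hg.inv h)

end LineDerivative

section Projection

variable {n : ℕ}

theorem tanProj_of_inner_eq_zero {x v : Euc n} (h : ⟪x, v⟫ = 0) : tanProj x v = v := by
  simp [tanProj, h]

theorem inner_tanProj {x : Euc n} (hx : x ≠ 0) (v : Euc n) : ⟪x, tanProj x v⟫ = 0 := by
  have : ‖x‖ ^ 2 ≠ 0 := by positivity
  rw [tanProj, inner_sub_right, inner_smul_right, real_inner_self_eq_norm_sq]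
  field_simp
  ring

theorem tanProj_tanProj {x : Euc n} (hx : x ≠ 0) (v : Euc n) :
    tanProj x (tanProj x v) = tanProj x v :=
  tanProj_of_inner_eq_zero (inner_tanProj hx v)

theorem differentiableAt_tanProj {x : Euc n} (hx : x ≠ 0) (v : Euc n) :
    DifferentiableAt ℝ (fun y => tanProj y v) x := by
  have h : ‖x‖ ^ 2 ≠ 0 := by positivity
  have h1 : DifferentiableAt ℝ (fun y : Euc n => ⟪y, v⟫) x :=
    differentiableAt_id.inner ℝ (differentiableAt_const v)
  have h2 : DifferentiableAt ℝ (fun y : Euc n => ‖y‖ ^ 2) x := differentiableAt_id.norm_sq ℝ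
  exact (differentiableAt_const v).sub ((h1.real_div h2 h).smul differentiableAt_id)

/-- Along a tangent line, the projection of the direction rotates towards the base point. -/
theorem hasDerivAt_tanProj_line {x u : Euc n} (hx : ‖x‖ = 1) (hxu : ⟪x, u⟫ = 0)
    (hu : ⟪u, u⟫ = 1) : HasDerivAt (fun t : ℝ => tanProj (x + t • u) u) (-x) 0 := by
  have hu' : ‖u‖ ^ 2 = 1 := by rw [← real_inner_self_eq_norm_sq, hu]
  have h1 : HasDerivAt (fun t : ℝ => ⟪x + t • u, u⟫) 1 0 := by
    simpa [hu'] using (hasDerivAt_line x u).inner ℝ (hasDerivAt_const (0 : ℝ) u)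
  have h2 : HasDerivAt (fun t : ℝ => ‖x + t • u‖ ^ 2) 0 0 := by
    simpa [hxu] using (hasDerivAt_line x u).norm_sq
  have h3 := (hasDerivAt_const (0 : ℝ) u).sub
    ((h1.div h2 (by simp [hx])).smul (hasDerivAt_line x u))
  simpa [tanProj, hx, hxu, Pi.sub_def] using h3

end Projection

section Homogeneous

variable {n : ℕ} {φ : Euc n → ℝ}

theorem two_le_smooth : (2 : WithTop ℕ∞) ≤ ((⊤ : ℕ∞) : WithTop ℕ∞) :=
  WithTop.coe_le_coe.2 (le_top : (2 : ℕ∞) ≤ ⊤)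

theorem SmoothFn.contDiffAt (hφs : SmoothFn φ) {y : Euc n} (hy : y ≠ 0) :
    ContDiffAt ℝ (⊤ : ℕ∞) φ y :=
  ContDiffOn.contDiffAt hφs (isOpen_ne.mem_nhds hy)

theorem SmoothFn.contDiffAt_gradient (hφs : SmoothFn φ) {y : Euc n} (hy : y ≠ 0) :
    ContDiffAt ℝ (⊤ : ℕ∞) (gradient φ) y :=
  (InnerProductSpace.toDual ℝ (Euc n)).symm.contDiff.contDiffAt.comp y
    ((hφs.contDiffAt hy).fderiv_right (by simp))

theorem Homog0.inner_gradient_self (hφ0 : Homog0 φ) (hφs : SmoothFn φ) {y : Euc n} (hy : y ≠ 0) :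
    ⟪gradient φ y, y⟫ = 0 := by
  rw [inner_gradient_left]
  refine ((hφs.contDiffAt hy).differentiableAt (by simp)).fderiv_apply_eq_of_line ?_
  refine (hasDerivAt_const (0 : ℝ) (φ y)).congr_of_eventuallyEq ?_
  filter_upwards [lt_mem_nhds (show (-1 : ℝ) < 0 by norm_num)] with t ht
  rw [← hφ0 (1 + t) y (by linarith), add_smul, one_smul]

theorem Homog0.pos (hφ0 : Homog0 φ) (hφpos : ∀ y ∈ uSphere n, 0 < φ y) {y : Euc n} (hy : y ≠ 0) :
    0 < φ y := by
  have hy' : 0 < ‖y‖ := norm_pos_iff.2 hy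
  rw [← hφ0 ‖y‖⁻¹ y (by positivity)]
  refine hφpos _ ?_
  simp [uSphere, norm_smul, hy'.ne']

theorem SmoothFn.inner_hessian_comm (hφs : SmoothFn φ) {y : Euc n} (hy : y ≠ 0) (v w : Euc n) :
    ⟪fderiv ℝ (gradient φ) y v, w⟫ = ⟪fderiv ℝ (gradient φ) y w, v⟫ := by
  have hG := (hφs.contDiffAt_gradient hy).differentiableAt (by simp)
  have hs : IsSymmSndFDerivAt ℝ φ y := (hφs.contDiffAt hy).isSymmSndFDerivAt (by simpa using two_le_smooth)
  have key (a b : Euc n) : fderiv ℝ (fderiv ℝ φ) y a b = ⟪fderiv ℝ (gradient φ) y a, b⟫ := by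
    have hd : DifferentiableAt ℝ (fderiv ℝ φ) y :=
      ((hφs.contDiffAt hy).fderiv_right (m := (⊤ : ℕ∞)) (by simp)).differentiableAt
        (by simp)
    have h1 : HasDerivAt (fun t : ℝ => fderiv ℝ φ (y + t • a) b) (fderiv ℝ (fderiv ℝ φ) y a b) 0 := by
      simpa using (hd.hasDerivAt_comp_line a).clm_apply (hasDerivAt_const (0 : ℝ) b)
    have h2 := (hG.hasDerivAt_comp_line a).inner ℝ (hasDerivAt_const (0 : ℝ) b)
    simp only [inner_gradient_left, inner_zero_right, zero_add] at h2
    exact h1.unique h2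
  rw [← key, ← key, hs.eq]

/-- Differentiating `⟪∇φ, y⟫ = 0` (Euler's identity). -/
theorem Homog0.hessian_self (hφ0 : Homog0 φ) (hφs : SmoothFn φ) {y : Euc n} (hy : y ≠ 0) :
    fderiv ℝ (gradient φ) y y = -gradient φ y := by
  refine ext_inner_right ℝ fun v => ?_
  have hG := (hφs.contDiffAt_gradient hy).differentiableAt (by simp)
  have h1 := (hG.hasDerivAt_comp_line v).inner ℝ (hasDerivAt_line y v)
  have h2 : HasDerivAt (fun t : ℝ => ⟪gradient φ (y + t • v), y + t • v⟫) 0 0 := by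
    refine (hasDerivAt_const (0 : ℝ) (0 : ℝ)).congr_of_eventuallyEq ?_
    have hc := (hasDerivAt_line y v).continuousAt
    filter_upwards [hc.eventually_ne (y := 0) (by simpa using hy)] with t ht
    exact hφ0.inner_gradient_self hφs ht
  have h3 := h1.unique h2
  simp only [zero_smul, add_zero] at h3
  rw [hφs.inner_hessian_comm hy, inner_neg_left]
  linarith

theorem SmoothFn.contDiffAt_hessian (hφs : SmoothFn φ) {y : Euc n} (hy : y ≠ 0) :
    ContDiffAt ℝ (⊤ : ℕ∞) (fderiv ℝ (gradient φ)) y :=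
  (hφs.contDiffAt_gradient hy).fderiv_right (by simp)

theorem SmoothFn.contDiffAt_third (hφs : SmoothFn φ) {y : Euc n} (hy : y ≠ 0) :
    ContDiffAt ℝ (⊤ : ℕ∞) (fderiv ℝ (fderiv ℝ (gradient φ))) y :=
  (hφs.contDiffAt_hessian hy).fderiv_right (by simp)

theorem SmoothFn.third_comm (hφs : SmoothFn φ) {y : Euc n} (hy : y ≠ 0) (u v : Euc n) :
    fderiv ℝ (fderiv ℝ (gradient φ)) y u v = fderiv ℝ (fderiv ℝ (gradient φ)) y v u :=
  ((hφs.contDiffAt_gradient hy).isSymmSndFDerivAt (by simpa using two_le_smooth)).eq u v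

theorem SmoothFn.inner_third_comm (hφs : SmoothFn φ) {y : Euc n} (hy : y ≠ 0) (u v w : Euc n) :
    ⟪fderiv ℝ (fderiv ℝ (gradient φ)) y u v, w⟫ = ⟪fderiv ℝ (fderiv ℝ (gradient φ)) y u w, v⟫ := by
  have hH := (hφs.contDiffAt_hessian hy).differentiableAt (by simp)
  have key (a b : Euc n) := ((hH.hasDerivAt_comp_line u).clm_apply
    (hasDerivAt_const (0 : ℝ) a)).inner ℝ (hasDerivAt_const (0 : ℝ) b)
  have h := (key v w).unique ((key w v).congr_of_eventuallyEq ?_)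
  · simpa using h
  · have hc := (hasDerivAt_line y u).continuousAt
    filter_upwards [hc.eventually_ne (y := 0) (by simpa using hy)] with t ht
    exact hφs.inner_hessian_comm ht v w

theorem SmoothFn.inner_fourth_comm (hφs : SmoothFn φ) {y : Euc n} (hy : y ≠ 0) (u w : Euc n) :
    ⟪fderiv ℝ (fderiv ℝ (fderiv ℝ (gradient φ))) y u u w, w⟫ =
      ⟪fderiv ℝ (fderiv ℝ (fderiv ℝ (gradient φ))) y w w u, u⟫ := by
  have hK := (hφs.contDiffAt_third hy).differentiableAt (by simp)
  have hc (a : Euc n) := ((hasDerivAt_line y a).continuousAt).eventually_ne (y := (0 : Euc n))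
    (by simpa using hy)
  have key (a b c : Euc n) := ((hK.hasDerivAt_comp_line a).clm_apply
    (hasDerivAt_const (0 : ℝ) b)).clm_apply (hasDerivAt_const (0 : ℝ) c)
  have swap (a b c : Euc n) : fderiv ℝ (fderiv ℝ (fderiv ℝ (gradient φ))) y a b c =
      fderiv ℝ (fderiv ℝ (fderiv ℝ (gradient φ))) y a c b := by
    have h := (key a b c).unique ((key a c b).congr_of_eventuallyEq (by
      filter_upwards [hc a] with t ht using hφs.third_comm ht b c))
    simpa using h
  have swap' (a b c d : Euc n) : ⟪fderiv ℝ (fderiv ℝ (fderiv ℝ (gradient φ))) y a b c, d⟫ =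
      ⟪fderiv ℝ (fderiv ℝ (fderiv ℝ (gradient φ))) y a b d, c⟫ := by
    have h := ((key a b c).inner ℝ (hasDerivAt_const (0 : ℝ) d)).unique
      (((key a b d).inner ℝ (hasDerivAt_const (0 : ℝ) c)).congr_of_eventuallyEq (by
        filter_upwards [hc a] with t ht using hφs.inner_third_comm ht b c d))
    simpa using h
  have hs : IsSymmSndFDerivAt ℝ (fderiv ℝ (gradient φ)) y :=
    (hφs.contDiffAt_hessian hy).isSymmSndFDerivAt (by simpa using two_le_smooth)
  rw [swap, hs.eq, swap', swap]

/-- Euler's identity for the third derivative. -/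
theorem Homog0.third_self (hφ0 : Homog0 φ) (hφs : SmoothFn φ) {y : Euc n} (hy : y ≠ 0)
    (w : Euc n) :
    fderiv ℝ (fderiv ℝ (gradient φ)) y y w = -(2 : ℝ) • fderiv ℝ (gradient φ) y w := by
  have hG := (hφs.contDiffAt_gradient hy).differentiableAt (by simp)
  have hH := (hφs.contDiffAt_hessian hy).differentiableAt (by simp)
  have h1 := (hH.hasDerivAt_comp_line w).clm_apply (hasDerivAt_line y w)
  have h2 := h1.unique ((hG.hasDerivAt_comp_line w).neg.congr_of_eventuallyEq (by
    have hc := (hasDerivAt_line y w).continuousAt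
    filter_upwards [hc.eventually_ne (y := 0) (by simpa using hy)] with t ht
    exact hφ0.hessian_self hφs ht))
  simp only [zero_smul, add_zero] at h2
  rw [hφs.third_comm hy, eq_sub_of_add_eq h2]
  module

end Homogeneous

section Tensor

variable {n : ℕ} {φ : Euc n → ℝ}

theorem Homog0.gradS_eq (hφ0 : Homog0 φ) (hφs : SmoothFn φ) {y : Euc n} (hy : y ≠ 0) :
    gradS φ y = gradient φ y :=
  tanProj_of_inner_eq_zero (by rw [real_inner_comm]; exact hφ0.inner_gradient_self hφs hy)

theorem Homog0.covD_eq (hφ0 : Homog0 φ) (hφs : SmoothFn φ) {y : Euc n} (hy : y ≠ 0)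
    (w : Euc n) : covD φ y w = ⟪gradient φ y, w⟫ := by
  rw [covD, ← inner_gradient_left, tanProj, inner_sub_right, inner_smul_right,
    hφ0.inner_gradient_self hφs hy, mul_zero, sub_zero]

theorem Homog0.hessS_eq (hφ0 : Homog0 φ) (hφs : SmoothFn φ) {y : Euc n} (hy : y ≠ 0)
    (v w : Euc n) : hessS φ y v w = ⟪fderiv ℝ (gradient φ) y (tanProj y v), w⟫ := by
  have hG := (hφs.contDiffAt_gradient hy).differentiableAt (by simp)
  have he : (fun z => covD φ z w) =ᶠ[nhds y] fun z => ⟪gradient φ z, w⟫ := by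
    filter_upwards [isOpen_ne.mem_nhds hy] with z hz using hφ0.covD_eq hφs hz w
  rw [hessS, he.fderiv_eq]
  exact (hG.inner ℝ (differentiableAt_const w)).fderiv_apply_eq_of_line
    (by simpa using (hG.hasDerivAt_comp_line _).inner ℝ (hasDerivAt_const (0 : ℝ) w))

theorem Homog0.Aform_eq (hφ0 : Homog0 φ) (hφs : SmoothFn φ) {y : Euc n} (hy : y ≠ 0)
    (v w : Euc n) : Aform φ y v w = ⟪fderiv ℝ (gradient φ) y (tanProj y v), w⟫ +
      metricCoeff φ y * ⟪tanProj y v, tanProj y w⟫ := by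
  rw [Aform, hφ0.hessS_eq hφs hy, hφ0.gradS_eq hφs hy, metricCoeff]

theorem Homog0.Aform_tanProj_self (hφ0 : Homog0 φ) (hφs : SmoothFn φ) {y : Euc n} (hy : y ≠ 0)
    (w : Euc n) : Aform φ y (tanProj y w) (tanProj y w) = ⟪fderiv ℝ (gradient φ) y w, w⟫ +
      2 * (⟪y, w⟫ / ‖y‖ ^ 2) * ⟪gradient φ y, w⟫ +
      metricCoeff φ y * (⟪w, w⟫ - ⟪y, w⟫ * (⟪y, w⟫ / ‖y‖ ^ 2)) := by
  have h : ‖y‖ ^ 2 ≠ 0 := by positivity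
  have h1 := hφ0.hessian_self hφs hy
  have h2 := hφ0.inner_gradient_self hφs hy
  have h3 : ⟪fderiv ℝ (gradient φ) y w, y⟫ = -⟪gradient φ y, w⟫ := by
    rw [hφs.inner_hessian_comm hy, h1, inner_neg_left]
  rw [hφ0.Aform_eq hφs hy, tanProj_tanProj hy]
  simp only [tanProj, map_sub, map_smul, inner_sub_left, inner_sub_right, inner_smul_left,
    inner_smul_right, h1, h3, inner_neg_left, h2, real_inner_self_eq_norm_sq y,
    real_inner_comm y w, conj_trivial]
  field_simp
  ring

theorem differentiableAt_metricCoeff (hφs : SmoothFn φ) {y : Euc n} (hy : y ≠ 0) (hp : 0 < φ y) :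
    DifferentiableAt ℝ (metricCoeff φ) y := by
  have hf := (hφs.contDiffAt hy).differentiableAt (by simp)
  have hG := (hφs.contDiffAt_gradient hy).differentiableAt (by simp)
  exact ((hf.sub (hf.inv hp.ne')).mul_const (2⁻¹ : ℝ)).sub
    ((hG.norm_sq ℝ).real_div (hf.const_mul 2) (by positivity))

theorem Homog0.covA1_self_eq (hφ0 : Homog0 φ) (hφs : SmoothFn φ) {y : Euc n} (hy : y ≠ 0)
    (hp : 0 < φ y) (v : Euc n) {w : Euc n} (hw : ⟪y, w⟫ = 0) :
    covA1 φ y v w w = ⟪fderiv ℝ (fderiv ℝ (gradient φ)) y (tanProj y v) w, w⟫ +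
      2 * (⟪tanProj y v, w⟫ / ‖y‖ ^ 2) * ⟪gradient φ y, w⟫ +
      fderiv ℝ (metricCoeff φ) y (tanProj y v) * ⟪w, w⟫ := by
  have hn : ‖y‖ ^ 2 ≠ 0 := by positivity
  have hG := (hφs.contDiffAt_gradient hy).differentiableAt (by simp)
  have hH := (hφs.contDiffAt_hessian hy).differentiableAt (by simp)
  have hm := differentiableAt_metricCoeff hφs hy hp
  have he : (fun z => Aform φ z (tanProj z w) (tanProj z w)) =ᶠ[nhds y] fun z =>
      ⟪fderiv ℝ (gradient φ) z w, w⟫ + 2 * (⟪z, w⟫ / ‖z‖ ^ 2) * ⟪gradient φ z, w⟫ +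
      metricCoeff φ z * (⟪w, w⟫ - ⟪z, w⟫ * (⟪z, w⟫ / ‖z‖ ^ 2)) := by
    filter_upwards [isOpen_ne.mem_nhds hy] with z hz using hφ0.Aform_tanProj_self hφs hz w
  rw [covA1, he.fderiv_eq]
  set p := tanProj y v
  have d1 : DifferentiableAt ℝ (fun z : Euc n => ⟪z, w⟫) y :=
    differentiableAt_id.inner ℝ (differentiableAt_const w)
  have d2 : DifferentiableAt ℝ (fun z : Euc n => ⟪z, w⟫ / ‖z‖ ^ 2) y :=
    d1.real_div (differentiableAt_fun_id.norm_sq ℝ) hn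
  have d3 := (hH.clm_apply (differentiableAt_const w)).inner ℝ (differentiableAt_const w)
  have d4 := hG.inner ℝ (differentiableAt_const w)
  refine ((d3.add ((d2.const_mul 2).mul d4)).add
    (hm.mul ((d1.mul d2).const_sub _))).fderiv_apply_eq_of_line ?_
  have c0 := hasDerivAt_const (0 : ℝ) w
  have l1 : HasDerivAt (fun t : ℝ => ⟪y + t • p, w⟫) ⟪p, w⟫ 0 := by
    simpa using (hasDerivAt_line y p).inner ℝ c0
  have l2 := l1.div (hasDerivAt_line y p).norm_sq (by simpa using hn)
  have l3 := ((hH.hasDerivAt_comp_line p).clm_apply c0).inner ℝ c0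
  have l4 := (hG.hasDerivAt_comp_line p).inner ℝ c0
  have l5 := (l3.add ((l2.const_mul 2).mul l4)).add
    ((hm.hasDerivAt_comp_line p).mul ((l1.mul l2).const_sub ⟪w, w⟫))
  refine l5.congr_deriv ?_
  simp [hw]
  field_simp
  simp

theorem Homog0.covA2_self_eq (hφ0 : Homog0 φ) (hφs : SmoothFn φ)
    (hφpos : ∀ y ∈ uSphere n, 0 < φ y) {x : Euc n} (hx : ‖x‖ = 1) {u w : Euc n}
    (hu : ⟪x, u⟫ = 0) (hw : ⟪x, w⟫ = 0) (huw : ⟪u, w⟫ = 0) (huu : ⟪u, u⟫ = 1)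
    (hww : ⟪w, w⟫ = 1)
    (hm : ContDiffAt ℝ (⊤ : ℕ∞) (metricCoeff φ) x) :
    covA2 φ x u u w w = ⟪fderiv ℝ (fderiv ℝ (fderiv ℝ (gradient φ))) x u u w, w⟫ +
      2 * ⟪fderiv ℝ (gradient φ) x w, w⟫ +
      (fderiv ℝ (fderiv ℝ (metricCoeff φ)) x u u - fderiv ℝ (metricCoeff φ) x x) := by
  have hx0 : x ≠ 0 := by rintro rfl; simp at hx
  have hG := (hφs.contDiffAt_gradient hx0).differentiableAt (by simp)
  have hK := (hφs.contDiffAt_third hx0).differentiableAt (by simp)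
  have hm' : DifferentiableAt ℝ (fderiv ℝ (metricCoeff φ)) x :=
    (hm.fderiv_right (m := (⊤ : ℕ∞)) (by simp)).differentiableAt (by simp)
  have he : (fun y => covA1 φ y (tanProj y u) (tanProj y w) (tanProj y w)) =ᶠ[nhds x] fun y =>
      ⟪fderiv ℝ (fderiv ℝ (gradient φ)) y (tanProj y u) (tanProj y w), tanProj y w⟫ +
      2 * (⟪tanProj y u, tanProj y w⟫ / ‖y‖ ^ 2) * ⟪gradient φ y, tanProj y w⟫ +
      fderiv ℝ (metricCoeff φ) y (tanProj y u) * ⟪tanProj y w, tanProj y w⟫ := by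
    filter_upwards [isOpen_ne.mem_nhds hx0] with y hy
    rw [hφ0.covA1_self_eq hφs hy (hφ0.pos hφpos hy) _ (inner_tanProj hy w), tanProj_tanProj hy]
  have du := differentiableAt_tanProj hx0 u
  have dw := differentiableAt_tanProj hx0 w
  rw [covA2, he.fderiv_eq, tanProj_of_inner_eq_zero hu]
  refine (((((hK.clm_apply du).clm_apply dw).inner ℝ dw).add
    ((((du.inner ℝ dw).real_div (differentiableAt_fun_id.norm_sq ℝ)
      (by simp [hx])).const_mul 2).mul
      (hG.inner ℝ dw))).add
    ((hm'.clm_apply du).mul (dw.inner ℝ dw))).fderiv_apply_eq_of_line ?_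
  have pw (t : ℝ) : tanProj (x + t • u) w = w :=
    tanProj_of_inner_eq_zero (by simp [inner_add_left, inner_smul_left, hw, huw])
  have pu (t : ℝ) : ⟪tanProj (x + t • u) u, w⟫ = 0 := by
    simp [tanProj, inner_sub_left, inner_add_left, inner_smul_left, hw, huw]
  have lu := hasDerivAt_tanProj_line hx hu huu
  have c0 := hasDerivAt_const (0 : ℝ) w
  have l := ((((hK.hasDerivAt_comp_line u).clm_apply lu).clm_apply c0).inner ℝ c0).add
    ((hm'.hasDerivAt_comp_line u).clm_apply lu)
  refine (l.congr_deriv ?_).congr_of_eventuallyEq (.of_forall fun t => ?_)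
  · simp [tanProj_of_inner_eq_zero hu, inner_add_left, hφ0.third_self hφs hx0, inner_smul_left]
    ring
  · simp only [Pi.add_apply, Pi.mul_apply, pw, pu, hww, zero_div, mul_zero, zero_mul, add_zero,
      mul_one]

theorem contDiffAt_metricCoeff (hφs : SmoothFn φ) {y : Euc n} (hy : y ≠ 0) (hp : 0 < φ y) :
    ContDiffAt ℝ (⊤ : ℕ∞) (metricCoeff φ) y := by
  have hf := hφs.contDiffAt hy
  have hG := hφs.contDiffAt_gradient hy
  exact ((hf.sub (hf.inv hp.ne')).div_const 2).sub
    ((hG.norm_sq ℝ).div (contDiffAt_const.mul hf) (by positivity))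

theorem fderiv_metricCoeff (hφs : SmoothFn φ) {y : Euc n} (hy : y ≠ 0) (hp : 0 < φ y)
    (v : Euc n) : fderiv ℝ (metricCoeff φ) y v =
      ⟪gradient φ y, v⟫ * ((1 + (φ y ^ 2)⁻¹) / 2 + ‖gradient φ y‖ ^ 2 / 2 * (φ y ^ 2)⁻¹) -
        ⟪fderiv ℝ (gradient φ) y v, gradient φ y⟫ * (φ y)⁻¹ := by
  have hf := (hφs.contDiffAt hy).differentiableAt (by simp)
  have hG := (hφs.contDiffAt_gradient hy).differentiableAt (by simp)
  have h0 : φ (y + (0 : ℝ) • v) ≠ 0 := by simpa using hp.ne'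
  refine (differentiableAt_metricCoeff hφs hy hp).fderiv_apply_eq_of_line ?_
  have lf := hf.hasDerivAt_comp_line v
  have l := ((lf.sub (lf.inv h0)).div_const 2).sub
    ((hG.hasDerivAt_comp_line v).norm_sq.div (lf.const_mul 2) (by simpa using h0))
  refine l.congr_deriv ?_
  rw [inner_gradient_left, real_inner_comm]
  simp
  field_simp
  ring

theorem fderiv_fderiv_metricCoeff (hφ0 : Homog0 φ) (hφs : SmoothFn φ)
    (hφpos : ∀ y ∈ uSphere n, 0 < φ y) {y : Euc n} (hy : y ≠ 0) (v : Euc n) :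
    fderiv ℝ (fderiv ℝ (metricCoeff φ)) y v v =
      ⟪fderiv ℝ (gradient φ) y v, v⟫ *
          ((1 + (φ y ^ 2)⁻¹) / 2 + ‖gradient φ y‖ ^ 2 / 2 * (φ y ^ 2)⁻¹) -
        ⟪gradient φ y, v⟫ ^ 2 * (1 + ‖gradient φ y‖ ^ 2) * (φ y ^ 3)⁻¹ +
        2 * ⟪gradient φ y, v⟫ * ⟪fderiv ℝ (gradient φ) y v, gradient φ y⟫ * (φ y ^ 2)⁻¹ -
        (⟪fderiv ℝ (fderiv ℝ (gradient φ)) y v v, gradient φ y⟫ +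
          ‖fderiv ℝ (gradient φ) y v‖ ^ 2) * (φ y)⁻¹ := by
  have hp := hφ0.pos hφpos hy
  have hf := (hφs.contDiffAt hy).differentiableAt (by simp)
  have hG := (hφs.contDiffAt_gradient hy).differentiableAt (by simp)
  have hH := (hφs.contDiffAt_hessian hy).differentiableAt (by simp)
  have hm' : DifferentiableAt ℝ (fderiv ℝ (metricCoeff φ)) y :=
    ((contDiffAt_metricCoeff hφs hy hp).fderiv_right (m := (⊤ : ℕ∞))
      (by simp)).differentiableAt (by simp)
  have h0 : φ (y + (0 : ℝ) • v) ≠ 0 := by simpa using hp.ne'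
  have c0 := hasDerivAt_const (0 : ℝ) v
  have lf := hf.hasDerivAt_comp_line v
  have lG := hG.hasDerivAt_comp_line v
  have l2 := (lf.pow 2).inv (pow_ne_zero 2 h0)
  have l := ((lG.inner ℝ c0).mul (((l2.const_add 1).div_const 2).add
    ((lG.norm_sq.div_const 2).mul l2))).sub
    ((((hH.hasDerivAt_comp_line v).clm_apply c0).inner ℝ lG).mul (lf.inv h0))
  have h1 := (hm'.hasDerivAt_comp_line v).clm_apply c0
  have h2 := h1.unique (l.congr_of_eventuallyEq (by
    have hc := (hasDerivAt_line y v).continuousAt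
    filter_upwards [hc.eventually_ne (y := 0) (by simpa using hy)] with t ht
    exact fderiv_metricCoeff hφs ht (hφ0.pos hφpos ht) v))
  simp only [zero_smul, add_zero, map_zero] at h2
  rw [h2, real_inner_comm _ (gradient φ y), ← real_inner_self_eq_norm_sq (fderiv ℝ (gradient φ) y v),
    inner_gradient_left]
  simp
  field_simp
  ring

end Tensor

/-- A tangent orthonormal frame together with the base point spans the ambient space. -/
theorem OrthoFrame.sum_add_self {n : ℕ} {x : Euc n} {e : Fin n → Euc n} (he : OrthoFrame x e)
    (hx : ‖x‖ = 1) (v : Euc n) : ∑ m, ⟪e m, v⟫ • e m + ⟪x, v⟫ • x = v := by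
  let b : Fin (n + 1) → Euc n := Fin.cons x e
  have hb : Orthonormal ℝ b := by
    rw [orthonormal_iff_ite]
    intro i j
    refine Fin.cases ?_ (fun i => ?_) i <;> refine Fin.cases ?_ (fun j => ?_) j
    · simp [b, hx]
    · simp [b, he.1, (Fin.succ_ne_zero j).symm]
    · simp [b, he.1, real_inner_comm x]
    · simp [b, he.2, Fin.succ_inj]
  obtain ⟨B, hB⟩ := Orthonormal.exists_orthonormalBasis_extension_of_card_eq
    (ι := Fin (n + 1)) (v := b) (s := Set.univ) (by simp)
    (hb.comp Subtype.val Subtype.val_injective)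
  have h := B.sum_repr' v
  simp only [hB _ (Set.mem_univ _), Fin.sum_univ_succ] at h
  rw [add_comm]
  simpa [b] using h

/-- **Commutation identity for second covariant derivatives of `A[φ]`** (Lemma 3.4 (3.7) of
Luo–Wei): at a point `x ∈ 𝕊ⁿ` where the Hessian of `φ` is diagonal in the orthonormal tangent
frame `e`, for all `i, α`:
`A_{iiαα} - A_{ααii} = -(Σ_m A_{ααm} φ_m)/φ
  - [-2φ_α²/φ² + |Dφ|²/(2φ²) + A_{αα}/φ + ½(1 + 1/φ²)] A_{αα}
  + (Σ_m A_{iim} φ_m)/φ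
  + [-2φ_i²/φ² + |Dφ|²/(2φ²) + A_{ii}/φ + ½(1 + 1/φ²)] A_{ii}`. -/
theorem second_derivative_commutation_of_A (n : ℕ) (φ : Euc n → ℝ)
    (hφ0 : Homog0 φ) (hφs : SmoothFn φ) (hφpos : ∀ y ∈ uSphere n, 0 < φ y)
    (x : Euc n) (hx : x ∈ uSphere n) (e : Fin n → Euc n) (he : OrthoFrame x e)
    (hdiag : ∀ i j, i ≠ j → hessS φ x (e i) (e j) = 0) :
    ∀ i α : Fin n,
      covA2 φ x (e α) (e α) (e i) (e i) - covA2 φ x (e i) (e i) (e α) (e α) =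
        -((∑ m, covA1 φ x (e m) (e α) (e α) * covD φ x (e m)) / φ x)
        - (-(2 * covD φ x (e α) ^ 2 / φ x ^ 2) + ‖gradS φ x‖ ^ 2 / (2 * φ x ^ 2) +
              Aform φ x (e α) (e α) / φ x + (1 / 2) * (1 + 1 / φ x ^ 2)) *
            Aform φ x (e α) (e α)
        + (∑ m, covA1 φ x (e m) (e i) (e i) * covD φ x (e m)) / φ x
        + (-(2 * covD φ x (e i) ^ 2 / φ x ^ 2) + ‖gradS φ x‖ ^ 2 / (2 * φ x ^ 2) +
              Aform φ x (e i) (e i) / φ x + (1 / 2) * (1 + 1 / φ x ^ 2)) *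
            Aform φ x (e i) (e i) := by
  intro i α
  rcases eq_or_ne i α with rfl | hne
  · ring
  have hx1 : ‖x‖ = 1 := by simpa [uSphere] using hx
  have hx0 : x ≠ 0 := by rintro rfl; simp at hx1
  have hp := hφpos x hx
  have hm := contDiffAt_metricCoeff hφs hx0 hp
  have hee (j : Fin n) : ⟪e j, e j⟫ = 1 := by simpa using he.2 j j
  have hαi : ⟪e α, e i⟫ = 0 := by simpa [hne.symm] using he.2 α i
  have hiα : ⟪e i, e α⟫ = 0 := by simpa [hne] using he.2 i α
  have hGx := hφ0.inner_gradient_self hφs hx0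
  have hG : ∑ m, ⟪e m, gradient φ x⟫ • e m = gradient φ x := by
    have h := he.sum_add_self hx1 (gradient φ x)
    rwa [real_inner_comm _ x, hGx, zero_smul, add_zero] at h
  have hH (j : Fin n) : fderiv ℝ (gradient φ) x (e j) =
      hessS φ x (e j) (e j) • e j - ⟪gradient φ x, e j⟫ • x := by
    have h := he.sum_add_self hx1 (fderiv ℝ (gradient φ) x (e j))
    have hs : ∑ m, ⟪e m, fderiv ℝ (gradient φ) x (e j)⟫ • e m = hessS φ x (e j) (e j) • e j := by
      rw [Finset.sum_eq_single j]
      · rw [hφ0.hessS_eq hφs hx0, tanProj_of_inner_eq_zero (he.1 j), real_inner_comm]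
      · intro m _ hmj
        have h0 := hdiag j m hmj.symm
        rw [hφ0.hessS_eq hφs hx0, tanProj_of_inner_eq_zero (he.1 j), real_inner_comm] at h0
        rw [h0, zero_smul]
      · simp
    rw [hs, real_inner_comm, hφs.inner_hessian_comm hx0, hφ0.hessian_self hφs hx0,
      inner_neg_left] at h
    rw [← h]
    module
  have hHG (j : Fin n) : ⟪fderiv ℝ (gradient φ) x (e j), gradient φ x⟫ =
      hessS φ x (e j) (e j) * ⟪gradient φ x, e j⟫ := by
    rw [hH, inner_sub_left, inner_smul_left, inner_smul_left, real_inner_comm _ x, hGx]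
    simp
  have hHH (j : Fin n) : ‖fderiv ℝ (gradient φ) x (e j)‖ ^ 2 =
      hessS φ x (e j) (e j) ^ 2 + ⟪gradient φ x, e j⟫ ^ 2 := by
    rw [← real_inner_self_eq_norm_sq, hH]
    simp only [inner_sub_left, inner_sub_right, inner_smul_left, inner_smul_right, hee, he.1,
      real_inner_comm x (e j), real_inner_self_eq_norm_sq x, hx1, conj_trivial]
    ring
  have hsum (j : Fin n) : ∑ m, covA1 φ x (e m) (e j) (e j) * covD φ x (e m) =
      ⟪fderiv ℝ (fderiv ℝ (gradient φ)) x (e j) (e j), gradient φ x⟫ +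
        2 * ⟪gradient φ x, e j⟫ ^ 2 + fderiv ℝ (metricCoeff φ) x (gradient φ x) := by
    let L : Euc n →ₗ[ℝ] ℝ :=
      { toFun := fun v => ⟪fderiv ℝ (fderiv ℝ (gradient φ)) x v (e j), e j⟫ +
          2 * ⟪v, e j⟫ * ⟪gradient φ x, e j⟫ + fderiv ℝ (metricCoeff φ) x v
        map_add' := fun a b => by simp [inner_add_left]; ring
        map_smul' := fun c a => by simp [inner_smul_left]; ring }
    have h1 : ∑ m, covA1 φ x (e m) (e j) (e j) * covD φ x (e m) = L (gradient φ x) := by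
      rw [← congrArg L hG, map_sum]
      refine Finset.sum_congr rfl fun m _ => ?_
      rw [hφ0.covA1_self_eq hφs hx0 hp _ (he.1 j), hφ0.covD_eq hφs hx0,
        tanProj_of_inner_eq_zero (he.1 m), hx1, hee, map_smul, real_inner_comm (gradient φ x) (e m)]
      simp [L]
      ring
    rw [h1]
    simp only [L, LinearMap.coe_mk, AddHom.coe_mk]
    rw [hφs.third_comm hx0, hφs.inner_third_comm hx0]
    ring
  have hA (j : Fin n) : Aform φ x (e j) (e j) = hessS φ x (e j) (e j) + metricCoeff φ x := by
    rw [Aform, hφ0.gradS_eq hφs hx0, tanProj_of_inner_eq_zero (he.1 j), hee, metricCoeff, mul_one]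
  have hh (j : Fin n) : ⟪fderiv ℝ (gradient φ) x (e j), e j⟫ = hessS φ x (e j) (e j) := by
    rw [hφ0.hessS_eq hφs hx0, tanProj_of_inner_eq_zero (he.1 j)]
  rw [hφ0.covA2_self_eq hφs hφpos hx1 (he.1 α) (he.1 i) hαi (hee α) (hee i) hm,
    hφ0.covA2_self_eq hφs hφpos hx1 (he.1 i) (he.1 α) hiα (hee i) (hee α) hm,
    hφs.inner_fourth_comm hx0 (e α) (e i), hsum, hsum,
    fderiv_fderiv_metricCoeff hφ0 hφs hφpos hx0, fderiv_fderiv_metricCoeff hφ0 hφs hφpos hx0,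
    hA, hA, hHG, hHG, hHH, hHH, hh, hh, hφ0.covD_eq hφs hx0, hφ0.covD_eq hφs hx0,
    hφ0.gradS_eq hφs hx0, metricCoeff]
  field_simp
  ring
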